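/- For all integers n ≥ 1 and m ≥ 1 there exists a constant C (depending only on m and n) such that for every bounded set P ⊆ ℝⁿ that is an intersection of at most m DH-half-spaces, and for every ε > 0, one has |μ_ε(P)| ≤ C. (Uniform boundedness of μ_ε(P) for a fixed number of half-spaces; Theorem 3.2(2) / Lemma 6.1(2).) -/

import Mathlib

open MeasureTheory Filter Metric

variable {n : ℕ} [NeZero n]

/-- A *DH-half-space* in `ℝⁿ` (upper half-space model of the double hyperbolic space `DHⁿ`):
either a closed ball whose center has first coordinate `0`, or the complement of an open ball
whose center has first coordinate `0`, or a closed affine half-space whose normal vector is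
nonzero with first coordinate `0`. -/
def IsDHHalfSpace (H : Set (EuclideanSpace ℝ (Fin n))) : Prop :=
  (∃ (c : EuclideanSpace ℝ (Fin n)) (r : ℝ), 0 < r ∧ c 0 = 0 ∧ H = closedBall c r) ∨
  (∃ (c : EuclideanSpace ℝ (Fin n)) (r : ℝ), 0 < r ∧ c 0 = 0 ∧ H = (ball c r)ᶜ) ∨
  (∃ (v : EuclideanSpace ℝ (Fin n)) (t : ℝ), v ≠ 0 ∧ v 0 = 0 ∧
    H = {x | t ≤ inner v x (𝕜 := ℝ)})

/-- A *DH-polytope* in `ℝⁿ`: a finite intersection of DH-half-spaces. -/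
def IsDHPolytope (P : Set (EuclideanSpace ℝ (Fin n))) : Prop :=
  ∃ S : Finset (Set (EuclideanSpace ℝ (Fin n))), (∀ H ∈ S, IsDHHalfSpace H) ∧ P = ⋂₀ ↑S

/-- `μ_ε(P) = ∫_P (x₀ - εi)^{-n} dx`. -/
noncomputable def dhInt (n : ℕ) [NeZero n] (P : Set (EuclideanSpace ℝ (Fin n))) (ε : ℝ) : ℂ :=
  ∫ x in P, ((x 0 : ℂ) - (ε : ℂ) * Complex.I) ^ (-(n : ℤ))

section
open scoped RealInnerProductSpace

section OrthogonalSplitting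

/-- Splitting off a unit vector `e`: the remaining coordinates are parametrized isometrically and
Lebesgue measure becomes a product measure. -/
theorem exists_orthogonal_splitting {d : ℕ} (e : EuclideanSpace ℝ (Fin (d + 1))) (he : ‖e‖ = 1) :
    ∃ j : EuclideanSpace ℝ (Fin d) →ₗᵢ[ℝ] EuclideanSpace ℝ (Fin (d + 1)),
      (∀ z, ⟪e, j z⟫ = 0) ∧
      MeasurePreserving (fun p : ℝ × EuclideanSpace ℝ (Fin d) => p.1 • e + j p.2) ∧
      MeasurableEmbedding (fun p : ℝ × EuclideanSpace ℝ (Fin d) => p.1 • e + j p.2) := by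
  obtain ⟨b, hb⟩ := Orthonormal.exists_orthonormalBasis_extension_of_card_eq
    (𝕜 := ℝ) (E := EuclideanSpace ℝ (Fin (d + 1))) (ι := Fin (d + 1)) (by simp)
    (v := fun _ => e) (s := {0}) (by
      rw [orthonormal_iff_ite]
      rintro ⟨i, hi⟩ ⟨k, hk⟩
      obtain rfl : i = 0 := hi
      obtain rfl : k = 0 := hk
      simp [he])
  have hb0 : b 0 = e := hb 0 rfl
  have h1 : e = b.repr.symm (WithLp.toLp 2 (Fin.cons 1 0)) := by
    rw [← hb0, ← OrthonormalBasis.repr_symm_single]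
    congr 1
    ext i
    refine Fin.cases ?_ (fun i => ?_) i <;> simp
  let j : EuclideanSpace ℝ (Fin d) →ₗᵢ[ℝ] EuclideanSpace ℝ (Fin (d + 1)) :=
    { toFun := fun z => b.repr.symm (WithLp.toLp 2 (Fin.cons 0 z.ofLp))
      map_add' := fun x y => by
        rw [← map_add]
        congr 1
        ext i
        refine Fin.cases ?_ (fun i => ?_) i <;> simp
      map_smul' := fun c x => by
        rw [← map_smul]
        congr 1
        ext i
        refine Fin.cases ?_ (fun i => ?_) i <;> simp
      norm_map' := fun x => by
        change ‖b.repr.symm _‖ = _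
        rw [LinearIsometryEquiv.norm_map, EuclideanSpace.norm_eq, EuclideanSpace.norm_eq,
          Fin.sum_univ_succ]
        simp }
  let Φ : ℝ × EuclideanSpace ℝ (Fin d) ≃ᵐ EuclideanSpace ℝ (Fin (d + 1)) :=
    (((MeasurableEquiv.refl ℝ).prodCongr (MeasurableEquiv.toLp 2 (Fin d → ℝ)).symm).trans
      (MeasurableEquiv.piFinSuccAbove (fun _ : Fin (d + 1) => ℝ) 0).symm).trans
      ((MeasurableEquiv.toLp 2 (Fin (d + 1) → ℝ)).trans
        b.repr.symm.toHomeomorph.toMeasurableEquiv)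
  have hΦ : (fun p : ℝ × EuclideanSpace ℝ (Fin d) => p.1 • e + j p.2) = Φ := by
    funext p
    have h2 : Φ p = b.repr.symm (WithLp.toLp 2 (Fin.cons p.1 p.2.ofLp)) := by
      change b.repr.symm (WithLp.toLp 2 _) = _
      congr 2
      change (Fin.insertNth (α := fun _ => ℝ) 0 p.1 p.2.ofLp : Fin (d + 1) → ℝ) = _
      simp
    rw [h2]
    change p.1 • e + b.repr.symm (WithLp.toLp 2 (Fin.cons 0 p.2.ofLp)) = _
    conv_lhs => rw [h1]
    rw [← map_smul, ← map_add]
    congr 1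
    ext i
    refine Fin.cases ?_ (fun i => ?_) i <;> simp
  refine ⟨j, fun z => ?_, ?_, ?_⟩
  · change ⟪e, b.repr.symm (WithLp.toLp 2 (Fin.cons 0 z.ofLp))⟫ = 0
    rw [h1, LinearIsometryEquiv.inner_map_map, PiLp.inner_apply, Fin.sum_univ_succ]
    simp
  · rw [hΦ]
    have h3 := (volume_preserving_piFinSuccAbove (fun _ : Fin (d + 1) => ℝ) 0).symm
    have h4 := (MeasurePreserving.id (volume : Measure ℝ)).prod
      (PiLp.volume_preserving_ofLp (Fin d))
    exact (b.repr.symm.measurePreserving.comp (PiLp.volume_preserving_toLp (Fin (d + 1)))).comp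
      (h3.comp h4)
  · rw [hΦ]
    exact Φ.measurableEmbedding

end OrthogonalSplitting

section Polyhedra

/-- The condition `t ≤ x` (if `b` is true) or `t < x` (if `b` is false). -/
def HalfLineCond (b : Bool) (t x : ℝ) : Prop := if b then t ≤ x else t < x

theorem measurableSet_halfLineCond (b : Bool) (t : ℝ) : MeasurableSet {x | HalfLineCond b t x} := by
  cases b
  · exact measurableSet_Ioi (a := t)
  · exact measurableSet_Ici (a := t)

theorem halfLineCond_mul_iff {b : Bool} {a t x : ℝ} (ha : 0 < a) :
    HalfLineCond b (a * t) (a * x) ↔ HalfLineCond b t x := by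
  cases b <;> simp [HalfLineCond, ha]

theorem halfLineCond_sub_iff {b : Bool} {a t x : ℝ} :
    HalfLineCond b (t - a) x ↔ HalfLineCond b t (a + x) := by
  cases b <;> simp [HalfLineCond, add_comm a, sub_lt_iff_lt_add]

theorem mem_uIcc_of_halfLineCond_not_iff {b : Bool} {t t' x : ℝ}
    (h : ¬(HalfLineCond b t' x ↔ HalfLineCond b t x)) : x ∈ Set.uIcc t t' := by
  rw [Set.mem_uIcc]
  cases b <;> simp only [HalfLineCond, if_true, if_false, Bool.false_eq_true] at h <;> grind

/-- A polyhedron in `ℝᵈ` cut out by `k` closed or open half-spaces (degenerate ones, with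
`v i = 0`, being allowed). -/
def polyhedron {d k : ℕ} (b : Fin k → Bool) (v : Fin k → EuclideanSpace ℝ (Fin d))
    (t : Fin k → ℝ) : Set (EuclideanSpace ℝ (Fin d)) :=
  {y | ∀ i, HalfLineCond (b i) (t i) ⟪v i, y⟫}

variable {d k : ℕ}

theorem measurableSet_polyhedron (b : Fin k → Bool) (v : Fin k → EuclideanSpace ℝ (Fin d))
    (t : Fin k → ℝ) : MeasurableSet (polyhedron b v t) := by
  have h : polyhedron b v t = ⋂ i, (fun y => ⟪v i, y⟫) ⁻¹' {x | HalfLineCond (b i) (t i) x} := by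
    ext y
    simp [polyhedron]
  rw [h]
  exact MeasurableSet.iInter fun i =>
    (Continuous.measurable (by fun_prop)) (measurableSet_halfLineCond _ _)

theorem smul_polyhedron (b : Fin k → Bool) (v : Fin k → EuclideanSpace ℝ (Fin d))
    (t : Fin k → ℝ) {a : ℝ} (ha : 0 < a) :
    polyhedron b v (fun i => a * t i) = (fun y => a • y) '' polyhedron b v t := by
  ext y
  rw [Set.image_smul, Set.mem_smul_set_iff_inv_smul_mem₀ ha.ne']
  refine forall_congr' fun i => ?_
  rw [← halfLineCond_mul_iff (x := ⟪v i, a⁻¹ • y⟫) ha, real_inner_smul_right,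
    mul_inv_cancel_left₀ ha.ne']

/-- A continuous function of `R² - ‖y‖²` that vanishes for `‖y‖ ≥ R` is integrable. -/
theorem integrable_comp_sq_sub_norm_sq {f : ℝ → ℂ} (hf : Continuous f) (h0 : ∀ u ≤ 0, f u = 0)
    (s : ℝ) : Integrable (fun y : EuclideanSpace ℝ (Fin d) => f (s - ‖y‖ ^ 2)) := by
  refine Continuous.integrable_of_hasCompactSupport (by fun_prop) ?_
  refine HasCompactSupport.intro (isCompact_closedBall 0 (√s)) fun y hy => h0 _ ?_
  rw [mem_closedBall_zero_iff, not_le] at hy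
  have := (Real.sqrt_lt' ((Real.sqrt_nonneg s).trans_lt hy)).1 hy
  linarith

/-- Moving one wall of a polyhedron from `t i` to `a * t i` changes the integral of a radial
function by an amount controlled by its integrals over the parallel sections. -/
theorem norm_setIntegral_polyhedron_update_sub_le {f : ℝ → ℂ} (hf : Continuous f)
    (h0 : ∀ u ≤ 0, f u = 0) {R B : ℝ} (hR : 0 < R)
    (hB : ∀ (τ : ℝ) (b : Fin k → Bool) (v : Fin k → EuclideanSpace ℝ (Fin d)) (t : Fin k → ℝ),
      ‖∫ z in polyhedron b v t, f (R ^ 2 - τ ^ 2 - ‖z‖ ^ 2)‖ ≤ B)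
    (b : Fin k → Bool) (v : Fin k → EuclideanSpace ℝ (Fin (d + 1))) (t : Fin k → ℝ) (i : Fin k)
    {a : ℝ} (ha : 1 / 2 < a) :
    ‖(∫ y in polyhedron b v (Function.update t i (a * t i)), f (R ^ 2 - ‖y‖ ^ 2)) -
      ∫ y in polyhedron b v t, f (R ^ 2 - ‖y‖ ^ 2)‖ ≤ 2 * R * B * |a - 1| := by
  have ha0 : 0 < a := by linarith
  have hB0 : 0 ≤ B := (norm_nonneg _).trans (hB 0 b (fun _ => 0) t)
  by_cases hv : v i = 0
  · have : polyhedron b v (Function.update t i (a * t i)) = polyhedron b v t := by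
      ext y
      refine forall_congr' fun l => ?_
      rcases eq_or_ne l i with rfl | hl
      · rw [Function.update_self, hv, inner_zero_left, ← halfLineCond_mul_iff (x := 0) ha0,
          mul_zero]
        rw [← halfLineCond_mul_iff (t := t l) (x := 0) ha0, mul_zero]
        rw [← halfLineCond_mul_iff (t := a * t l) (x := 0) ha0, mul_zero]
      · rw [Function.update_of_ne hl]
    rw [this, sub_self, norm_zero]
    positivity
  have hvn : 0 < ‖v i‖ := norm_pos_iff.2 hv
  obtain ⟨e, he⟩ : ∃ e : EuclideanSpace ℝ (Fin (d + 1)), e = ‖v i‖⁻¹ • v i := ⟨_, rfl⟩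
  have hve : v i = ‖v i‖ • e := by rw [he, smul_inv_smul₀ hvn.ne']
  have hen : ‖e‖ = 1 := by rw [he, norm_smul, norm_inv, norm_norm, inv_mul_cancel₀ hvn.ne']
  obtain ⟨j, hj, hmp, hme⟩ := exists_orthogonal_splitting e hen
  set c : ℝ := ‖v i‖⁻¹ * t i with hc
  have htc : t i = ‖v i‖ * c := by rw [hc, mul_inv_cancel_left₀ hvn.ne']
  set w : Fin k → EuclideanSpace ℝ (Fin d) := fun l =>
    if l = i then 0 else ContinuousLinearMap.adjoint j.toContinuousLinearMap (v l) with hw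
  set b' := Function.update b i true with hb'
  set s : ℝ → Fin k → ℝ := fun τ l => if l = i then 0 else t l - τ * ⟪v l, e⟫ with hs
  have hnorm : ∀ (τ : ℝ) (z), ‖τ • e + j z‖ ^ 2 = τ ^ 2 + ‖z‖ ^ 2 := fun τ z => by
    rw [@norm_add_sq_real, real_inner_smul_left, hj, norm_smul, hen, j.norm_map]
    simp
  have hei : ∀ (τ : ℝ) (z), ⟪v i, τ • e + j z⟫ = ‖v i‖ * τ := fun τ z => by
    have h1 : ⟪v i, τ • e + j z⟫ = ⟪‖v i‖ • e, τ • e + j z⟫ := by rw [← hve]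
    rw [h1, inner_add_right, real_inner_smul_right, real_inner_smul_left, real_inner_smul_left, hj,
      real_inner_self_eq_norm_sq, hen]
    ring
  have hmem : ∀ (c' τ : ℝ) (z), (τ • e + j z ∈ polyhedron b v (Function.update t i (‖v i‖ * c'))) ↔
      (HalfLineCond (b i) c' τ ∧ z ∈ polyhedron b' w (s τ)) := by
    intro c' τ z
    constructor
    · intro h
      refine ⟨?_, fun l => ?_⟩
      · have := h i
        rwa [Function.update_self, hei, halfLineCond_mul_iff hvn] at this
      · rcases eq_or_ne l i with rfl | hl
        · simp [hb', hw, hs, HalfLineCond]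
        · have := h l
          rw [Function.update_of_ne hl, inner_add_right, real_inner_smul_right] at this
          simp only [hb', hw, hs, hl, if_false, Function.update_of_ne hl]
          rw [ContinuousLinearMap.adjoint_inner_left, halfLineCond_sub_iff]
          exact this
    · rintro ⟨h, hz⟩ l
      rcases eq_or_ne l i with rfl | hl
      · rwa [Function.update_self, hei, halfLineCond_mul_iff hvn]
      · have := hz l
        simp only [hb', hw, hs, hl, if_false, Function.update_of_ne hl] at this
        rw [ContinuousLinearMap.adjoint_inner_left, halfLineCond_sub_iff] at this
        rw [Function.update_of_ne hl, inner_add_right, real_inner_smul_right]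
        exact this
  have hint := integrable_comp_sq_sub_norm_sq (d := d + 1) hf h0 (R ^ 2)
  have hI : ∀ c' : ℝ, Integrable (fun p : ℝ × EuclideanSpace ℝ (Fin d) =>
        (polyhedron b v (Function.update t i (‖v i‖ * c'))).indicator
          (fun y => f (R ^ 2 - ‖y‖ ^ 2)) (p.1 • e + j p.2)) := fun c' =>
    (hmp.integrable_comp_emb hme).2 (hint.indicator (measurableSet_polyhedron _ _ _))
  have hsec : ∀ c' τ : ℝ, ∫ z, (polyhedron b v (Function.update t i (‖v i‖ * c'))).indicator
      (fun y => f (R ^ 2 - ‖y‖ ^ 2)) (τ • e + j z) = {x | HalfLineCond (b i) c' x}.indicator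
        (fun τ => ∫ z in polyhedron b' w (s τ), f (R ^ 2 - τ ^ 2 - ‖z‖ ^ 2)) τ := by
    intro c' τ
    by_cases hτ : HalfLineCond (b i) c' τ
    · rw [Set.indicator_of_mem (by exact hτ),
        ← integral_indicator (measurableSet_polyhedron _ _ _)]
      refine integral_congr_ae (Eventually.of_forall fun z => ?_)
      by_cases hz : z ∈ polyhedron b' w (s τ)
      · simp only [Set.indicator_of_mem hz, Set.indicator_of_mem ((hmem _ _ _).2 ⟨hτ, hz⟩), hnorm,
          sub_sub]
      · simp only [Set.indicator_of_notMem hz,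
          Set.indicator_of_notMem (fun h => hz ((hmem _ _ _).1 h).2)]
    · simp [Set.indicator, hτ, hmem]
  have hrw : ∀ c' : ℝ, ∫ y in polyhedron b v (Function.update t i (‖v i‖ * c')),
      f (R ^ 2 - ‖y‖ ^ 2) = ∫ τ, ({x | HalfLineCond (b i) c' x}.indicator
        (fun τ => ∫ z in polyhedron b' w (s τ), f (R ^ 2 - τ ^ 2 - ‖z‖ ^ 2)) τ) := by
    intro c'
    rw [← integral_indicator (measurableSet_polyhedron _ _ _), ← hmp.integral_comp hme,
      Measure.volume_eq_prod, integral_prod _ (hI c')]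
    exact integral_congr_ae (Eventually.of_forall (hsec c'))
  have hI' : ∀ c' : ℝ, Integrable (fun τ => ({x | HalfLineCond (b i) c' x}.indicator
        (fun τ => ∫ z in polyhedron b' w (s τ), f (R ^ 2 - τ ^ 2 - ‖z‖ ^ 2)) τ)) := by
    intro c'
    exact (hI c').integral_prod_left.congr (Eventually.of_forall (hsec c'))
  have h1 := hrw (a * c)
  have h2 := hrw c
  rw [show ‖v i‖ * (a * c) = a * t i by rw [htc]; ring] at h1
  rw [← htc, Function.update_eq_self] at h2
  rw [h1, h2, ← integral_sub (hI' _) (hI' _)]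
  set S : Set ℝ := if |c| ≤ 2 * R then Set.uIcc c (a * c) else ∅ with hS
  have hSm : MeasurableSet S := by
    rw [hS]; split_ifs
    · exact measurableSet_uIcc
    · exact MeasurableSet.empty
  have hSv : volume.real S ≤ 2 * R * |a - 1| := by
    rw [hS]; split_ifs with h
    · rw [Measure.real, Real.volume_interval, ENNReal.toReal_ofReal (abs_nonneg _)]
      rw [show a * c - c = c * (a - 1) by ring, abs_mul]
      gcongr
    · simp only [measureReal_empty]; positivity
  have hSfin : volume S ≠ ⊤ := by
    rw [hS]; split_ifs
    · simp [Real.volume_interval]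
    · simp
  calc _ ≤ ∫ τ, S.indicator (fun _ => B) τ := by
        refine norm_integral_le_of_norm_le ?_ (Eventually.of_forall fun τ => ?_)
        · exact (integrable_indicator_iff hSm).2 (integrableOn_const hSfin)
        · by_cases hiff : HalfLineCond (b i) (a * c) τ ↔ HalfLineCond (b i) c τ
          · have hset : τ ∈ {x | HalfLineCond (b i) (a * c) x} ↔
                τ ∈ {x | HalfLineCond (b i) c x} := hiff
            rw [Set.indicator_eq_indicator hset rfl, sub_self, norm_zero]
            exact Set.indicator_nonneg (fun _ _ => hB0) _
          · have hτ := mem_uIcc_of_halfLineCond_not_iff hiff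
            have hle : ‖Set.indicator {x | HalfLineCond (b i) (a * c) x}
                (fun τ => ∫ z in polyhedron b' w (s τ), f (R ^ 2 - τ ^ 2 - ‖z‖ ^ 2)) τ -
              Set.indicator {x | HalfLineCond (b i) c x}
                (fun τ => ∫ z in polyhedron b' w (s τ), f (R ^ 2 - τ ^ 2 - ‖z‖ ^ 2)) τ‖ ≤
                ‖∫ z in polyhedron b' w (s τ), f (R ^ 2 - τ ^ 2 - ‖z‖ ^ 2)‖ := by
              simp only [Set.indicator]
              split_ifs <;> simp
            refine hle.trans ?_
            by_cases hcR : |c| ≤ 2 * R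
            · rw [Set.indicator_of_mem (by rwa [hS, if_pos hcR])]
              exact hB _ _ _ _
            · have hz : ∀ z : EuclideanSpace ℝ (Fin d), f (R ^ 2 - τ ^ 2 - ‖z‖ ^ 2) = 0 := by
                intro z
                apply h0
                have h3 : R ≤ |τ| := by
                  rw [not_le] at hcR
                  rw [Set.mem_uIcc] at hτ
                  rcases abs_cases c with ⟨h, h'⟩ | ⟨h, h'⟩ <;>
                  rcases abs_cases τ with ⟨h4, h5⟩ | ⟨h4, h5⟩ <;> rw [h4] <;>
                  rcases hτ with hτ | hτ <;> nlinarith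
                have : R ^ 2 ≤ τ ^ 2 := by
                  rw [← sq_abs τ]; gcongr
                nlinarith [sq_nonneg ‖z‖]
              simp only [hz, integral_zero, norm_zero]
              exact Set.indicator_nonneg (fun _ _ => hB0) _
    _ = volume.real S * B := by
        rw [integral_indicator hSm, setIntegral_const, smul_eq_mul]
    _ ≤ 2 * R * |a - 1| * B := by gcongr
    _ = _ := by ring

end Polyhedra

section RadialIntegrals

/-- `f 0, …, f p` are successive derivatives, vanish on `(-∞, 0]`, and satisfy the homogeneous bounds
`‖f i (r²)‖ ≤ C * r ^ (q - 2 * i)`. -/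
structure IsDerivChain (p q : ℕ) (C : ℝ) (f : ℕ → ℝ → ℂ) : Prop where
  continuous : ∀ i ≤ p, Continuous (f i)
  hasDerivAt : ∀ i < p, ∀ u, HasDerivAt (f i) (f (i + 1) u) u
  eq_zero : ∀ i ≤ p, ∀ u ≤ 0, f i u = 0
  norm_le : ∀ i ≤ p, ∀ r : ℝ, 0 < r → ‖f i (r ^ 2)‖ * r ^ (2 * i) ≤ C * r ^ q

theorem IsDerivChain.nonneg {p q : ℕ} {C : ℝ} {f : ℕ → ℝ → ℂ} (h : IsDerivChain p q C f) :
    0 ≤ C := by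
  have := h.norm_le 0 (Nat.zero_le _) 1 one_pos
  simp only [one_pow, mul_one] at this
  exact (norm_nonneg _).trans this

theorem IsDerivChain.pred {p q : ℕ} {C : ℝ} {f : ℕ → ℝ → ℂ} (h : IsDerivChain (p + 1) q C f) :
    IsDerivChain p q C f where
  continuous i hi := h.continuous i (by omega)
  hasDerivAt i hi := h.hasDerivAt i (by omega)
  eq_zero i hi := h.eq_zero i (by omega)
  norm_le i hi := h.norm_le i (by omega)

/-- If `F` is a `(p+1)`-st primitive of `g`, then `u * F' - p * F` is a `p`-th primitive of
`u * g`. -/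
theorem IsDerivChain.id_mul {p q : ℕ} {C : ℝ} {f : ℕ → ℝ → ℂ} (h : IsDerivChain (p + 1) q C f) :
    IsDerivChain p q ((p + 1) * C) (fun i u => u * f (i + 1) u + ((i : ℂ) - p) * f i u) where
  continuous i hi := by
    have h1 := h.continuous i (by omega)
    have h2 := h.continuous (i + 1) (by omega)
    fun_prop
  hasDerivAt i hi u := by
    have h1 := h.hasDerivAt i (by omega) u
    have h2 := h.hasDerivAt (i + 1) (by omega) u
    have h3 : HasDerivAt (fun u : ℝ => (u : ℂ)) 1 u := Complex.ofRealCLM.hasDerivAt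
    refine ((h3.mul h2).add (h1.const_mul ((i : ℂ) - p))).congr_deriv ?_
    push_cast
    ring
  eq_zero i hi u hu := by
    rw [h.eq_zero i (by omega) u hu, h.eq_zero (i + 1) (by omega) u hu]
    ring
  norm_le i hi r hr := by
    have h1 := h.norm_le i (by omega) r hr
    have h2 := h.norm_le (i + 1) (by omega) r hr
    have h3 : ‖(i : ℂ) - p‖ ≤ p := by
      rw [← Nat.cast_sub hi |> fun h => (by rw [h]; ring : -((p - i : ℕ) : ℂ) = (i : ℂ) - p),
        norm_neg, Complex.norm_natCast]
      exact_mod_cast Nat.sub_le _ _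
    calc _ ≤ (r ^ 2 * ‖f (i + 1) (r ^ 2)‖ + p * ‖f i (r ^ 2)‖) * r ^ (2 * i) := by
          gcongr
          refine (norm_add_le _ _).trans ?_
          rw [norm_mul, norm_mul]
          gcongr
          rw [Complex.norm_real, Real.norm_of_nonneg (by positivity)]
      _ = ‖f (i + 1) (r ^ 2)‖ * r ^ (2 * (i + 1)) + p * (‖f i (r ^ 2)‖ * r ^ (2 * i)) := by ring
      _ ≤ C * r ^ q + p * (C * r ^ q) := by gcongr
      _ = _ := by ring

variable {d k : ℕ}

theorem norm_setIntegral_polyhedron_smul_sub_le {f : ℝ → ℂ} (hf : Continuous f)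
    (h0 : ∀ u ≤ 0, f u = 0) {R B : ℝ} (hR : 0 < R)
    (hB : ∀ (τ : ℝ) (b : Fin k → Bool) (v : Fin k → EuclideanSpace ℝ (Fin d)) (t : Fin k → ℝ),
      ‖∫ z in polyhedron b v t, f (R ^ 2 - τ ^ 2 - ‖z‖ ^ 2)‖ ≤ B)
    (b : Fin k → Bool) (v : Fin k → EuclideanSpace ℝ (Fin (d + 1))) (t : Fin k → ℝ)
    {a : ℝ} (ha : 1 / 2 < a) :
    ‖(∫ y in polyhedron b v (fun i => a * t i), f (R ^ 2 - ‖y‖ ^ 2)) -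
      ∫ y in polyhedron b v t, f (R ^ 2 - ‖y‖ ^ 2)‖ ≤ k * (2 * R * B * |a - 1|) := by
  have key : ∀ s : Finset (Fin k),
      ‖(∫ y in polyhedron b v (fun i => if i ∈ s then a * t i else t i), f (R ^ 2 - ‖y‖ ^ 2)) -
        ∫ y in polyhedron b v t, f (R ^ 2 - ‖y‖ ^ 2)‖ ≤ s.card * (2 * R * B * |a - 1|) := by
    intro s
    induction s using Finset.induction_on with
    | empty => simp
    | insert i s hi ih =>
      have h1 := norm_setIntegral_polyhedron_update_sub_le hf h0 hR hB b v
        (fun i => if i ∈ s then a * t i else t i) i ha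
      have h2 : Function.update (fun i => if i ∈ s then a * t i else t i) i
          (a * (fun i => if i ∈ s then a * t i else t i) i) =
          fun l => if l ∈ insert i s then a * t l else t l := by
        funext l
        rcases eq_or_ne l i with rfl | hl
        · simp [hi]
        · simp [hl]
      rw [h2] at h1
      rw [Finset.card_insert_of_notMem hi]
      refine (norm_sub_le_norm_sub_add_norm_sub _ _ _).trans ((add_le_add h1 ih).trans_eq ?_)
      push_cast
      ring
  simpa using key Finset.univ

/-- Dilating a polyhedron and differentiating: a weak form of the divergence theorem for the
Euler field. -/
theorem norm_integral_euler_le {f f' : ℝ → ℂ} (hf : Continuous f) (hf' : Continuous f')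
    (hd : ∀ u, HasDerivAt f (f' u) u)
    (h0 : ∀ u ≤ 0, f u = 0) (h0' : ∀ u ≤ 0, f' u = 0) {R B : ℝ} (hR : 0 < R)
    (hB : ∀ (τ : ℝ) (b : Fin k → Bool) (v : Fin k → EuclideanSpace ℝ (Fin d)) (t : Fin k → ℝ),
      ‖∫ z in polyhedron b v t, f (R ^ 2 - τ ^ 2 - ‖z‖ ^ 2)‖ ≤ B)
    (b : Fin k → Bool) (v : Fin k → EuclideanSpace ℝ (Fin (d + 1))) (t : Fin k → ℝ) :
    ‖(d + 1 : ℂ) * (∫ y in polyhedron b v t, f (R ^ 2 - ‖y‖ ^ 2)) -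
      2 * ∫ y in polyhedron b v t, (‖y‖ : ℂ) ^ 2 * f' (R ^ 2 - ‖y‖ ^ 2)‖ ≤ k * (2 * R * B) := by
  set Q := polyhedron b v t with hQ
  have hB0 : 0 ≤ B := (norm_nonneg _).trans (hB 0 b (fun _ => 0) t)
  have hscale : ∀ a : ℝ, 0 < a → ∫ y in polyhedron b v (fun i => a * t i), f (R ^ 2 - ‖y‖ ^ 2) =
      (a : ℂ) ^ (d + 1) * ∫ y in Q, f (R ^ 2 - a ^ 2 * ‖y‖ ^ 2) := by
    intro a ha
    have := Measure.setIntegral_comp_smul_of_pos (volume : Measure (EuclideanSpace ℝ (Fin (d + 1))))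
      (fun y => f (R ^ 2 - ‖y‖ ^ 2)) Q ha
    simp only [norm_smul, mul_pow, Real.norm_eq_abs, sq_abs, finrank_euclideanSpace,
      Fintype.card_fin] at this
    rw [this, smul_polyhedron b v t ha, Set.image_smul, Complex.real_smul]
    have : (a : ℂ) ≠ 0 := by exact_mod_cast ha.ne'
    push_cast
    field_simp
    rw [hQ]
  obtain ⟨M, hM⟩ : ∃ M, ∀ u ∈ Set.Icc (-(R ^ 2)) (R ^ 2), ‖f' u‖ ≤ M :=
    isCompact_Icc.exists_bound_of_continuousOn hf'.continuousOn
  have hM0 : 0 ≤ M := (norm_nonneg _).trans (hM 0 ⟨by nlinarith, by nlinarith⟩)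
  have hder : HasDerivAt (fun a : ℝ => ∫ y in Q, f (R ^ 2 - a ^ 2 * ‖y‖ ^ 2))
      (∫ y in Q, -(2 * (1 : ℝ) * ‖y‖ ^ 2 : ℝ) • f' (R ^ 2 - (1 : ℝ) ^ 2 * ‖y‖ ^ 2)) 1 := by
    refine (hasDerivAt_integral_of_dominated_loc_of_deriv_le
      (F := fun (a : ℝ) y => f (R ^ 2 - a ^ 2 * ‖y‖ ^ 2))
      (F' := fun (a : ℝ) y => -(2 * a * ‖y‖ ^ 2 : ℝ) • f' (R ^ 2 - a ^ 2 * ‖y‖ ^ 2))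
      (bound := (closedBall 0 (2 * R)).indicator fun _ => 16 * R ^ 2 * M)
      (Ioo_mem_nhds (show (1 / 2 : ℝ) < 1 by norm_num) (show (1 : ℝ) < 2 by norm_num))
      (Eventually.of_forall fun a => (Continuous.aestronglyMeasurable (by fun_prop))) ?_
      (Continuous.aestronglyMeasurable (by fun_prop)) (Eventually.of_forall fun y a ha => ?_) ?_
      (Eventually.of_forall fun y a ha => ?_)).2
    · simpa using (integrable_comp_sq_sub_norm_sq hf h0 (R ^ 2)).restrict
    · by_cases hy : y ∈ closedBall (0 : EuclideanSpace ℝ (Fin (d + 1))) (2 * R)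
      · rw [Set.indicator_of_mem hy]
        rw [mem_closedBall_zero_iff] at hy
        have hfb : ‖f' (R ^ 2 - a ^ 2 * ‖y‖ ^ 2)‖ ≤ M := by
          by_cases hu : 0 ≤ R ^ 2 - a ^ 2 * ‖y‖ ^ 2
          · refine hM _ ⟨by nlinarith, ?_⟩
            have : 0 ≤ a ^ 2 * ‖y‖ ^ 2 := by positivity
            linarith
          · rw [h0' _ (not_le.1 hu).le, norm_zero]
            exact hM0
        have ha0 : 0 < a := by linarith [ha.1]
        rw [norm_smul, norm_neg, Real.norm_of_nonneg (by positivity)]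
        have : ‖y‖ ^ 2 ≤ (2 * R) ^ 2 := by gcongr
        calc 2 * a * ‖y‖ ^ 2 * ‖f' (R ^ 2 - a ^ 2 * ‖y‖ ^ 2)‖
            ≤ 2 * 2 * (2 * R) ^ 2 * M := by gcongr; exact ha.2.le
          _ = _ := by ring
      · rw [Set.indicator_of_notMem hy, h0', smul_zero, norm_zero]
        rw [mem_closedBall_zero_iff, not_le] at hy
        have h1 : R < a * ‖y‖ := by nlinarith [ha.1, norm_nonneg y]
        nlinarith
    · exact ((integrable_indicator_iff measurableSet_closedBall).2
        (integrableOn_const measure_closedBall_lt_top.ne)).integrableOn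
    · have h1 : HasDerivAt (fun a : ℝ => R ^ 2 - a ^ 2 * ‖y‖ ^ 2) (-(2 * a * ‖y‖ ^ 2)) a := by
        refine (((hasDerivAt_pow 2 a).mul_const (‖y‖ ^ 2)).const_sub (R ^ 2)).congr_deriv ?_
        simp
      exact (hd _).scomp a h1
  have hpow : HasDerivAt (fun a : ℝ => (a : ℂ) ^ (d + 1)) (d + 1 : ℂ) 1 := by
    refine ((Complex.ofRealCLM.hasDerivAt (x := (1 : ℝ))).pow (d + 1)).congr_deriv ?_
    simp
  have hφ := hpow.mul hder
  have hlip := hφ.le_of_lip' (C := k * (2 * R * B)) (by positivity) (by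
    filter_upwards [Ioi_mem_nhds (show (1 / 2 : ℝ) < 1 by norm_num)] with a ha
    have h1 := norm_setIntegral_polyhedron_smul_sub_le hf h0 hR hB b v t ha
    rw [hscale a (by linarith [Set.mem_Ioi.1 ha])] at h1
    simp only [Pi.mul_apply, Real.norm_eq_abs]
    refine (le_of_eq ?_).trans (h1.trans_eq (by ring))
    simp [hQ])
  refine (le_of_eq ?_).trans hlip
  have hJ : ∫ y in Q, -(2 * (1 : ℝ) * ‖y‖ ^ 2 : ℝ) • f' (R ^ 2 - (1 : ℝ) ^ 2 * ‖y‖ ^ 2) =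
      -(2 * ∫ y in Q, (‖y‖ : ℂ) ^ 2 * f' (R ^ 2 - ‖y‖ ^ 2)) := by
    rw [← integral_const_mul, ← integral_neg]
    refine integral_congr_ae (Eventually.of_forall fun y => ?_)
    simp only [Complex.real_smul, one_pow, one_mul]
    push_cast
    ring
  rw [hJ]
  simp [sub_eq_add_neg]

/-- Uniform bound for integrals over polyhedra of singular radial functions that are given as the
`p`-th derivative of a bounded one. -/
theorem exists_norm_integral_polyhedron_le (k q p : ℕ) : ∀ d : ℕ, p ≤ d → 2 * p ≤ d + q →
    ∃ K : ℝ, 0 ≤ K ∧ ∀ (C : ℝ) (f : ℕ → ℝ → ℂ), IsDerivChain p q C f → ∀ R : ℝ, 0 < R →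
      ∀ (b : Fin k → Bool) (v : Fin k → EuclideanSpace ℝ (Fin d)) (t : Fin k → ℝ),
        ‖∫ y in polyhedron b v t, f p (R ^ 2 - ‖y‖ ^ 2)‖ ≤ K * C * R ^ (d + q - 2 * p) := by
  induction p with
  | zero =>
    intro d _ _
    refine ⟨volume.real (closedBall (0 : EuclideanSpace ℝ (Fin d)) 1), measureReal_nonneg, ?_⟩
    intro C f hf R hR b v t
    have hC := hf.nonneg
    rw [← integral_indicator (measurableSet_polyhedron _ _ _)]
    have hvol : volume.real (closedBall (0 : EuclideanSpace ℝ (Fin d)) R) =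
        R ^ d * volume.real (closedBall (0 : EuclideanSpace ℝ (Fin d)) 1) := by
      rw [Measure.real, Measure.addHaar_closedBall' _ _ hR.le, ENNReal.toReal_mul,
        ENNReal.toReal_ofReal (by positivity), finrank_euclideanSpace, Fintype.card_fin,
        Measure.real]
    calc _ ≤ ∫ y, (closedBall (0 : EuclideanSpace ℝ (Fin d)) R).indicator
          (fun _ => C * R ^ q) y := by
          refine norm_integral_le_of_norm_le ((integrable_indicator_iff measurableSet_closedBall).2
            (integrableOn_const measure_closedBall_lt_top.ne)) (Eventually.of_forall fun y => ?_)
          refine (norm_indicator_le_norm_self _ _).trans ?_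
          by_cases hy : ‖y‖ < R
          · rw [Set.indicator_of_mem (by simpa using hy.le)]
            have hpos : 0 < R ^ 2 - ‖y‖ ^ 2 := by nlinarith [norm_nonneg y]
            have h1 := hf.norm_le 0 le_rfl _ (Real.sqrt_pos.2 hpos)
            rw [Real.sq_sqrt hpos.le, mul_zero, pow_zero, mul_one] at h1
            refine h1.trans ?_
            gcongr
            rw [Real.sqrt_le_left hR.le]
            nlinarith
          · rw [hf.eq_zero 0 le_rfl _ (by nlinarith), norm_zero]
            exact Set.indicator_nonneg (fun _ _ => by positivity) _
      _ = volume.real (closedBall (0 : EuclideanSpace ℝ (Fin d)) 1) * C * R ^ (d + q - 2 * 0) := by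
          rw [integral_indicator measurableSet_closedBall, setIntegral_const, hvol, smul_eq_mul]
          simp only [mul_zero, Nat.sub_zero, pow_add]
          ring
  | succ p ih =>
    intro d hd hdq
    obtain ⟨d, rfl⟩ : ∃ d', d = d' + 1 := ⟨d - 1, by omega⟩
    obtain ⟨K₁, hK₁, h₁⟩ := ih (d + 1) (by omega) (by omega)
    obtain ⟨K₂, hK₂, h₂⟩ := ih d (by omega) (by omega)
    refine ⟨K₁ * (p + 1) + ((d + 1) * K₁ + 2 * k * K₂) / 2, by positivity, ?_⟩
    intro C f hf R hR b v t
    have hC := hf.nonneg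
    set e := d + 1 + q - 2 * (p + 1) with he
    have e1 : d + 1 + q - 2 * p = e + 2 := by omega
    have e2 : d + q - 2 * p = e + 1 := by omega
    rw [e1] at h₁
    rw [e2] at h₂
    have hA := h₁ _ _ hf.id_mul R hR b v t
    have hI := h₁ _ _ hf.pred R hR b v t
    have hB : ∀ (τ : ℝ) (b : Fin k → Bool) (v : Fin k → EuclideanSpace ℝ (Fin d)) (t : Fin k → ℝ),
        ‖∫ z in polyhedron b v t, f p (R ^ 2 - τ ^ 2 - ‖z‖ ^ 2)‖ ≤ K₂ * C * R ^ (e + 1) := by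
      intro τ b v t
      by_cases hτ : R ^ 2 - τ ^ 2 ≤ 0
      · have : ∀ z : EuclideanSpace ℝ (Fin d), f p (R ^ 2 - τ ^ 2 - ‖z‖ ^ 2) = 0 := fun z =>
          hf.eq_zero p (by omega) _ (by nlinarith [sq_nonneg ‖z‖])
        simp only [this, integral_zero, norm_zero]
        positivity
      · rw [not_le] at hτ
        have h3 := h₂ _ _ hf.pred _ (Real.sqrt_pos.2 hτ) b v t
        rw [Real.sq_sqrt hτ.le] at h3
        refine h3.trans ?_
        gcongr
        rw [Real.sqrt_le_left hR.le]
        nlinarith [sq_nonneg τ]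
    have hE := norm_integral_euler_le (hf.continuous p (by omega)) (hf.continuous (p + 1) le_rfl)
      (hf.hasDerivAt p (by omega)) (hf.eq_zero p (by omega)) (hf.eq_zero (p + 1) le_rfl) hR hB b v t
    set Q := polyhedron b v t
    have hfi := integrable_comp_sq_sub_norm_sq (d := d + 1) (hf.continuous (p + 1) le_rfl)
      (hf.eq_zero (p + 1) le_rfl) (R ^ 2)
    have hci : Integrable (fun y : EuclideanSpace ℝ (Fin (d + 1)) =>
        ((R ^ 2 - ‖y‖ ^ 2 : ℝ) : ℂ) * f (p + 1) (R ^ 2 - ‖y‖ ^ 2)) :=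
      integrable_comp_sq_sub_norm_sq (f := fun u => (u : ℂ) * f (p + 1) u)
        (by have := hf.continuous (p + 1) le_rfl; fun_prop)
        (fun u hu => by rw [hf.eq_zero (p + 1) le_rfl u hu, mul_zero]) _
    have hsi : Integrable (fun y : EuclideanSpace ℝ (Fin (d + 1)) =>
        (‖y‖ : ℂ) ^ 2 * f (p + 1) (R ^ 2 - ‖y‖ ^ 2)) := by
      refine ((hfi.const_mul ((R : ℂ) ^ 2)).sub hci).congr (Eventually.of_forall fun y => ?_)
      simp only [Pi.sub_apply]
      push_cast
      ring
    have hsplit : (R : ℂ) ^ 2 * ∫ y in Q, f (p + 1) (R ^ 2 - ‖y‖ ^ 2) =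
        (∫ y in Q, ((R ^ 2 - ‖y‖ ^ 2 : ℝ) : ℂ) * f (p + 1) (R ^ 2 - ‖y‖ ^ 2)) +
        ∫ y in Q, (‖y‖ : ℂ) ^ 2 * f (p + 1) (R ^ 2 - ‖y‖ ^ 2) := by
      rw [← integral_add hci.integrableOn hsi.integrableOn, ← integral_const_mul]
      refine integral_congr_ae (Eventually.of_forall fun y => ?_)
      simp only
      push_cast
      ring
    simp only [sub_self, zero_mul, add_zero] at hA
    set I := ∫ y in Q, f (p + 1) (R ^ 2 - ‖y‖ ^ 2)
    set I₀ := ∫ y in Q, f p (R ^ 2 - ‖y‖ ^ 2)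
    set J := ∫ y in Q, (‖y‖ : ℂ) ^ 2 * f (p + 1) (R ^ 2 - ‖y‖ ^ 2)
    set U := ∫ y in Q, ((R ^ 2 - ‖y‖ ^ 2 : ℝ) : ℂ) * f (p + 1) (R ^ 2 - ‖y‖ ^ 2)
    have hJ : 2 * ‖J‖ ≤ (d + 1) * ‖I₀‖ + k * (2 * R * (K₂ * C * R ^ (e + 1))) := by
      have h3 : (2 : ℂ) * J = (d + 1 : ℂ) * I₀ - ((d + 1 : ℂ) * I₀ - 2 * J) := by ring
      have h4 : ‖(2 : ℂ) * J‖ = 2 * ‖J‖ := by simp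
      have h5 : ‖(d + 1 : ℂ) * I₀‖ = (d + 1) * ‖I₀‖ := by
        rw [norm_mul]
        congr 1
        exact_mod_cast Complex.norm_natCast (d + 1)
      rw [← h4, h3, ← h5]
      exact (norm_sub_le _ _).trans (by gcongr)
    have hfin : R ^ 2 * ‖I‖ ≤ ‖U‖ + ‖J‖ := by
      have h3 : ‖(R : ℂ) ^ 2 * I‖ = R ^ 2 * ‖I‖ := by
        rw [norm_mul, norm_pow, Complex.norm_real, Real.norm_of_nonneg hR.le]
      rw [← h3, hsplit]
      exact norm_add_le _ _
    have hI' : (d + 1) * ‖I₀‖ ≤ (d + 1) * (K₁ * C * R ^ (e + 2)) := by gcongr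
    refine le_of_mul_le_mul_left (a := R ^ 2) ?_ (by positivity)
    have h6 : R ^ 2 * ((K₁ * (p + 1) + ((d + 1) * K₁ + 2 * k * K₂) / 2) * C * R ^ e) =
        K₁ * ((p + 1) * C) * R ^ (e + 2) + ((d + 1) * (K₁ * C * R ^ (e + 2)) +
          k * (2 * R * (K₂ * C * R ^ (e + 1)))) / 2 := by ring
    rw [h6]
    linarith

end RadialIntegrals

section Kernel

/-- The truncated power integral `∫_{-r}^r (r² - x²)^k h(x) dx`. -/
noncomputable def sqSubIntegral (h : ℝ → ℂ) (k : ℕ) (r : ℝ) : ℂ :=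
  ∫ x in -r..r, ((r ^ 2 - x ^ 2 : ℝ) : ℂ) ^ k * h x

theorem sqSubIntegral_succ {h : ℝ → ℂ} (hh : Continuous h) (k : ℕ) (r : ℝ) :
    sqSubIntegral h (k + 1) r =
      (r : ℂ) ^ 2 * sqSubIntegral h k r - sqSubIntegral (fun x => (x : ℂ) ^ 2 * h x) k r := by
  unfold sqSubIntegral
  rw [← intervalIntegral.integral_const_mul, ← intervalIntegral.integral_sub
    (Continuous.intervalIntegrable (by fun_prop) _ _)
    (Continuous.intervalIntegrable (by fun_prop) _ _)]
  refine intervalIntegral.integral_congr fun x _ => ?_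
  push_cast
  ring

theorem hasDerivAt_sqSubIntegral_zero {h : ℝ → ℂ} (hh : Continuous h) (r : ℝ) :
    HasDerivAt (sqSubIntegral h 0) (h r + h (-r)) r := by
  have h1 : sqSubIntegral h 0 = fun r => (∫ x in (0 : ℝ)..r, h x) - ∫ x in (0 : ℝ)..(-r), h x := by
    funext r
    rw [intervalIntegral.integral_interval_sub_left (hh.intervalIntegrable _ _)
      (hh.intervalIntegrable _ _)]
    simp [sqSubIntegral]
  rw [h1]
  have h2 := hh.integral_hasStrictDerivAt 0 r
  have h3 := (hh.integral_hasStrictDerivAt 0 (-r)).hasDerivAt.scomp r (hasDerivAt_neg r)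
  refine (h2.hasDerivAt.sub h3).congr_deriv ?_
  simp

theorem hasDerivAt_sqSubIntegral_succ (k : ℕ) : ∀ {h : ℝ → ℂ}, Continuous h → ∀ r : ℝ,
    HasDerivAt (sqSubIntegral h (k + 1)) (2 * (k + 1) * r * sqSubIntegral h k r) r := by
  induction k with
  | zero =>
    intro h hh r
    rw [show sqSubIntegral h (0 + 1) = _ from funext fun r => sqSubIntegral_succ hh 0 r]
    have h1 : HasDerivAt (fun r : ℝ => (r : ℂ) ^ 2) (2 * r) r := by
      refine ((Complex.ofRealCLM.hasDerivAt (x := r)).pow 2).congr_deriv ?_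
      simp
    refine ((h1.mul (hasDerivAt_sqSubIntegral_zero hh r)).sub
      (hasDerivAt_sqSubIntegral_zero (by fun_prop) r)).congr_deriv ?_
    push_cast
    ring
  | succ k ih =>
    intro h hh r
    rw [show sqSubIntegral h (k + 1 + 1) = _ from funext fun r => sqSubIntegral_succ hh (k + 1) r]
    have h1 : HasDerivAt (fun r : ℝ => (r : ℂ) ^ 2) (2 * r) r := by
      refine ((Complex.ofRealCLM.hasDerivAt (x := r)).pow 2).congr_deriv ?_
      simp
    refine ((h1.mul (ih hh r)).sub (ih (by fun_prop) r)).congr_deriv ?_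
    rw [sqSubIntegral_succ hh k r]
    push_cast
    ring

theorem continuous_sqSubIntegral {h : ℝ → ℂ} (hh : Continuous h) (k : ℕ) :
    Continuous (sqSubIntegral h k) := by
  refine continuous_iff_continuousAt.2 fun r => ?_
  cases k with
  | zero => exact (hasDerivAt_sqSubIntegral_zero hh r).continuousAt
  | succ k => exact (hasDerivAt_sqSubIntegral_succ k hh r).continuousAt

theorem hasDerivAt_sqSubIntegral_sqrt {h : ℝ → ℂ} (hh : Continuous h) (k : ℕ) (u : ℝ) :
    HasDerivAt (fun u => sqSubIntegral h (k + 1) (√u) / (k + 1).factorial)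
      (sqSubIntegral h k (√u) / k.factorial) u := by
  have hc : ∀ k : ℕ, Continuous fun u => sqSubIntegral h k (√u) / k.factorial := fun k =>
    ((continuous_sqSubIntegral hh k).comp Real.continuous_sqrt).div_const _
  refine hasDerivAt_of_hasDerivAt_of_ne' (x := 0) (fun u hu => ?_) (hc _).continuousAt
    (hc k).continuousAt u
  rcases hu.lt_or_gt with hu | hu
  · have h0 : ∀ k : ℕ, ∀ u ≤ 0, sqSubIntegral h k (√u) / k.factorial = 0 := fun k u hu => by
      simp [Real.sqrt_eq_zero_of_nonpos hu, sqSubIntegral]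
    rw [h0 k u hu.le]
    refine (hasDerivAt_const u (0 : ℂ)).congr_of_eventuallyEq ?_
    filter_upwards [Iio_mem_nhds hu] with v hv using h0 (k + 1) v (le_of_lt hv)
  · refine (((hasDerivAt_sqSubIntegral_succ k hh (√u)).scomp u
      (Real.hasDerivAt_sqrt hu.ne')).div_const _).congr_deriv ?_
    have h1 : ((√u : ℝ) : ℂ) ≠ 0 := by exact_mod_cast (Real.sqrt_pos.2 hu).ne'
    have h2 : (k.factorial : ℂ) ≠ 0 := by exact_mod_cast k.factorial_ne_zero
    have h3 : (k + 1 : ℂ) ≠ 0 := by exact_mod_cast k.succ_ne_zero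
    rw [Complex.real_smul, Nat.factorial_succ]
    push_cast
    field_simp

/-- The kernel `(x - εi)^{-N}`. -/
noncomputable def dhKernel (N : ℕ) (ε : ℝ) (x : ℂ) : ℂ := (x - ε * Complex.I) ^ (-(N : ℤ))

theorem continuous_dhKernel (N : ℕ) {ε : ℝ} (hε : 0 < ε) :
    Continuous fun x : ℝ => dhKernel N ε x := by
  refine Continuous.zpow₀ (by fun_prop) _ fun x => Or.inl fun h => ?_
  have := congrArg Complex.im h
  simp [hε.ne'] at this

theorem norm_sqSubIntegral_dhKernel_le (N k : ℕ) {ε r : ℝ} (hε : 0 < ε) (hr : 0 < r) :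
    ‖sqSubIntegral (fun x => dhKernel N ε x) k r‖ * r ^ N ≤ 4 * r * (3 * r ^ 2) ^ k := by
  set g : ℂ → ℂ := fun z => ((r : ℂ) ^ 2 - z ^ 2) ^ k * dhKernel N ε z with hg
  set M := (3 * r ^ 2) ^ k / r ^ N with hM
  have hgM : ∀ z : ℂ, |z.re| ≤ r → z.im ≤ 0 → |z.im| ≤ r → (r ≤ |z.re| ∨ r ≤ |z.im|) →
      ‖g z‖ ≤ M := by
    intro z hre him0 him hor
    have h1 : ‖(r : ℂ) ^ 2 - z ^ 2‖ ≤ 3 * r ^ 2 := by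
      refine (norm_sub_le _ _).trans ?_
      rw [norm_pow, norm_pow, Complex.norm_real, Real.norm_of_nonneg hr.le, Complex.sq_norm,
        Complex.normSq_apply]
      have := sq_le_sq' (abs_le.1 hre).1 (abs_le.1 hre).2
      have := sq_le_sq' (abs_le.1 him).1 (abs_le.1 him).2
      nlinarith
    have h2 : r ≤ ‖z - ε * Complex.I‖ := by
      rcases hor with h | h
      · refine h.trans ((le_of_eq ?_).trans (Complex.abs_re_le_norm _))
        simp
      · refine h.trans (le_trans ?_ (Complex.abs_im_le_norm _))
        simp only [Complex.sub_im, Complex.mul_im, Complex.ofReal_re, Complex.I_im, mul_one,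
          Complex.ofReal_im, Complex.I_re, mul_zero, add_zero]
        rw [abs_of_nonpos him0, abs_of_nonpos (by linarith)]
        linarith
    rw [hg, hM]
    simp only [dhKernel, norm_mul, norm_pow, zpow_neg, zpow_natCast, norm_inv]
    rw [div_eq_mul_inv]
    gcongr
  have hcauchy := Complex.integral_boundary_rect_eq_zero_of_differentiableOn g
    (-r - r * Complex.I) r (by
      intro z hz
      have hz2 : z.im ≤ 0 := by
        have := hz.2
        simp only [Set.mem_preimage, Complex.sub_im, Complex.neg_im, Complex.ofReal_im, neg_zero,
          Complex.mul_im, Complex.ofReal_re, Complex.I_im, mul_one, Complex.I_re, mul_zero,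
          add_zero, zero_sub, Set.mem_uIcc] at this
        rcases this with h | h <;> linarith [h.1, h.2]
      have hne : z - ε * Complex.I ≠ 0 := fun h => by
        have := congrArg Complex.im h
        simp at this
        linarith
      refine DifferentiableAt.differentiableWithinAt ?_
      refine DifferentiableAt.mul (by fun_prop) ?_
      exact DifferentiableAt.zpow (by fun_prop) (Or.inl hne))
  simp only [Complex.sub_re, Complex.neg_re, Complex.ofReal_re, Complex.mul_re, Complex.I_re,
    mul_zero, Complex.ofReal_im, Complex.I_im, mul_one, sub_zero, Complex.sub_im, Complex.neg_im,
    neg_zero, Complex.mul_im, add_zero, zero_sub, Complex.ofReal_neg, Complex.ofReal_zero,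
    zero_mul, smul_eq_mul] at hcauchy
  have hmain : sqSubIntegral (fun x => dhKernel N ε x) k r = ∫ x in -r..r, g x := by
    refine intervalIntegral.integral_congr fun x _ => ?_
    simp [hg]
  set A := ∫ x in -r..r, g (x + -r * Complex.I)
  set B := ∫ y in -r..0, g (r + y * Complex.I)
  set D := ∫ y in -r..0, g (-r + y * Complex.I)
  have hA : ‖A‖ ≤ M * (2 * r) := by
    refine (intervalIntegral.norm_integral_le_of_norm_le_const (C := M) fun x hx => ?_).trans_eq ?_
    · rw [Set.uIoc_of_le (by linarith)] at hx
      refine hgM _ ?_ ?_ ?_ (Or.inr ?_) <;>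
        simp [abs_of_pos hr, abs_le, hr.le, hx.1.le, hx.2]
    · rw [abs_of_nonneg (by linarith)]
      ring
  have hBD : ∀ s : ℝ, |s| = r → ‖∫ y in -r..0, g (s + y * Complex.I)‖ ≤ M * r := by
    intro s hs
    refine (intervalIntegral.norm_integral_le_of_norm_le_const (C := M) fun y hy => ?_).trans_eq ?_
    · rw [Set.uIoc_of_le (by linarith)] at hy
      have := hy.1
      refine hgM _ ?_ ?_ ?_ (Or.inl ?_) <;> simp [hs, hy.2, abs_le]
      constructor <;> linarith [hy.2]
    · rw [zero_sub, neg_neg, abs_of_pos hr]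
  have hB := hBD r (abs_of_pos hr)
  have hD := hBD (-r) (by rw [abs_neg, abs_of_pos hr])
  rw [Complex.ofReal_neg] at hD
  rw [hmain, show ∫ x in -r..r, g x = A + Complex.I * B - Complex.I * D by
    linear_combination -hcauchy]
  have h1 : ‖A + Complex.I * B - Complex.I * D‖ ≤ M * (4 * r) := by
    have h2 := norm_sub_le (A + Complex.I * B) (Complex.I * D)
    have h3 := norm_add_le A (Complex.I * B)
    rw [norm_mul, Complex.norm_I, one_mul] at h2 h3
    linarith
  calc _ ≤ M * (4 * r) * r ^ N := by gcongr
    _ = _ := by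
      rw [hM]
      field_simp

theorem isDerivChain_dhKernel (d : ℕ) {ε : ℝ} (hε : 0 < ε) :
    IsDerivChain d d (4 * 3 ^ d) (fun i u =>
      sqSubIntegral (fun x => dhKernel (d + 1) ε x) (d - i) (√u) / (d - i).factorial) where
  continuous i _ := ((continuous_sqSubIntegral (continuous_dhKernel _ hε) _).comp
    Real.continuous_sqrt).div_const _
  hasDerivAt i hi u := by
    obtain ⟨k, hk⟩ : ∃ k, d = i + 1 + k := ⟨d - (i + 1), by omega⟩
    rw [show d - i = k + 1 by omega, show d - (i + 1) = k by omega]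
    exact hasDerivAt_sqSubIntegral_sqrt (continuous_dhKernel _ hε) k u
  eq_zero i _ u hu := by simp [Real.sqrt_eq_zero_of_nonpos hu, sqSubIntegral]
  norm_le i hi r hr := by
    obtain ⟨k, rfl⟩ : ∃ k, d = i + k := ⟨d - i, by omega⟩
    rw [Real.sqrt_sq hr.le, Nat.add_sub_cancel_left, norm_div, Complex.norm_natCast]
    have h1 := norm_sqSubIntegral_dhKernel_le (i + k + 1) k hε hr
    set Z := ‖sqSubIntegral (fun x => dhKernel (i + k + 1) ε x) k r‖
    have h2 : Z / k.factorial ≤ Z :=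
      div_le_self (norm_nonneg _) (by exact_mod_cast k.factorial_pos)
    have h3 : (3 : ℝ) ^ k ≤ 3 ^ (i + k) := pow_le_pow_right₀ (by norm_num) (by omega)
    refine le_of_mul_le_mul_right ?_ (pow_pos hr (i + k + 1))
    calc Z / k.factorial * r ^ (2 * i) * r ^ (i + k + 1)
        ≤ Z * r ^ (2 * i) * r ^ (i + k + 1) := by gcongr
      _ = Z * r ^ (i + k + 1) * r ^ (2 * i) := by ring
      _ ≤ 4 * r * (3 * r ^ 2) ^ k * r ^ (2 * i) := by gcongr
      _ = 4 * 3 ^ k * r ^ (i + k) * r ^ (i + k + 1) := by ring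
      _ ≤ 4 * 3 ^ (i + k) * r ^ (i + k) * r ^ (i + k + 1) := by gcongr

end Kernel

section Translation

variable {d k : ℕ}

theorem sub_norm_sq_eq (w y : EuclideanSpace ℝ (Fin d)) (s : ℝ) :
    ⟪w, (2⁻¹ : ℝ) • w + y⟫ + s - ‖(2⁻¹ : ℝ) • w + y‖ ^ 2 = s + ‖w‖ ^ 2 / 4 - ‖y‖ ^ 2 := by
  rw [norm_add_sq_real, inner_add_right, real_inner_smul_left, real_inner_smul_right, norm_smul,
    real_inner_self_eq_norm_sq, Real.norm_of_nonneg (by norm_num)]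
  ring

theorem integrable_comp_affine_sub_norm_sq {f : ℝ → ℂ} (hf : Continuous f)
    (h0 : ∀ u ≤ 0, f u = 0) (w : EuclideanSpace ℝ (Fin d)) (s : ℝ) :
    Integrable (fun z => f (⟪w, z⟫ + s - ‖z‖ ^ 2)) := by
  refine ((integrable_comp_sq_sub_norm_sq hf h0 (s + ‖w‖ ^ 2 / 4)).comp_add_left
    (-((2⁻¹ : ℝ) • w))).congr (Eventually.of_forall fun z => ?_)
  simp only [← sub_norm_sq_eq, add_neg_cancel_left]

theorem setIntegral_polyhedron_comp_affine_sub_norm_sq (f : ℝ → ℂ)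
    (b : Fin k → Bool) (v : Fin k → EuclideanSpace ℝ (Fin d)) (t : Fin k → ℝ)
    (w : EuclideanSpace ℝ (Fin d)) (s : ℝ) :
    ∫ z in polyhedron b v t, f (⟪w, z⟫ + s - ‖z‖ ^ 2) =
      ∫ y in polyhedron b v (fun i => t i - ⟪v i, (2⁻¹ : ℝ) • w⟫), f (s + ‖w‖ ^ 2 / 4 - ‖y‖ ^ 2) := by
  rw [← integral_indicator (measurableSet_polyhedron _ _ _),
    ← integral_indicator (measurableSet_polyhedron _ _ _),
    ← integral_add_left_eq_self _ ((2⁻¹ : ℝ) • w)]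
  congr 1
  funext y
  have hmem : (2⁻¹ : ℝ) • w + y ∈ polyhedron b v t ↔
      y ∈ polyhedron b v (fun i => t i - ⟪v i, (2⁻¹ : ℝ) • w⟫) :=
    forall_congr' fun i => by rw [halfLineCond_sub_iff, inner_add_right]
  by_cases hy : (2⁻¹ : ℝ) • w + y ∈ polyhedron b v t
  · rw [Set.indicator_of_mem hy, Set.indicator_of_mem (hmem.1 hy), sub_norm_sq_eq]
  · rw [Set.indicator_of_notMem hy, Set.indicator_of_notMem (hmem.not.1 hy)]

/-- The bound for the contribution of a single (co-)ball over a polyhedral cell. -/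
theorem exists_norm_integral_dhKernel_cell_le (d k : ℕ) : ∃ K : ℝ, 0 ≤ K ∧ ∀ ε : ℝ, 0 < ε →
    ∀ (b : Fin k → Bool) (v : Fin k → EuclideanSpace ℝ (Fin d)) (t : Fin k → ℝ)
      (w : EuclideanSpace ℝ (Fin d)) (s : ℝ),
      ‖∫ z in polyhedron b v t,
        sqSubIntegral (fun x => dhKernel (d + 1) ε x) 0 (√(⟪w, z⟫ + s - ‖z‖ ^ 2))‖ ≤ K := by
  obtain ⟨K, hK, h⟩ := exists_norm_integral_polyhedron_le k d d d le_rfl (by omega)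
  refine ⟨K * (4 * 3 ^ d), by positivity, fun ε hε b v t w s => ?_⟩
  rw [setIntegral_polyhedron_comp_affine_sub_norm_sq
    (fun u => sqSubIntegral (fun x => dhKernel (d + 1) ε x) 0 (√u))]
  rcases le_or_gt (s + ‖w‖ ^ 2 / 4) 0 with hρ | hρ
  · have h0 : ∀ y : EuclideanSpace ℝ (Fin d), √(s + ‖w‖ ^ 2 / 4 - ‖y‖ ^ 2) = 0 := fun y =>
      Real.sqrt_eq_zero_of_nonpos (by nlinarith [sq_nonneg ‖y‖])
    simp only [h0, sqSubIntegral, neg_zero, intervalIntegral.integral_same, integral_zero, norm_zero]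
    positivity
  · have h1 := h _ _ (isDerivChain_dhKernel d hε) _ (Real.sqrt_pos.2 hρ) b v
      (fun i => t i - ⟪v i, (2⁻¹ : ℝ) • w⟫)
    rw [Real.sq_sqrt hρ.le, show d + d - 2 * d = 0 by omega, pow_zero, mul_one] at h1
    simpa using h1

end Translation

section Slices

variable {k : ℕ}

/-- Among the constraints `0 ≤ g l - σ l * T` on `T`, the endpoint `σ i * g i` coming from the
`i`-th one is admissible, and `i` is the first index of its sign with this endpoint. -/
def IsEndpoint (σ g : Fin k → ℝ) (i : Fin k) : Prop :=
  ∀ l, HalfLineCond (!decide (σ l = σ i ∧ l < i)) 0 (g l - σ l * (σ i * g i))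

theorem exists_first_min (σ g : Fin k → ℝ) {s : ℝ} (h : ∃ i, σ i = s) :
    ∃ i, σ i = s ∧ ∀ l, σ l = s → g i ≤ g l ∧ (l < i → g i < g l) := by
  obtain ⟨i, hi, hmin⟩ := Finset.exists_min_image (Finset.univ.filter fun i => σ i = s)
    (fun i => toLex (g i, i)) (by simpa [Finset.Nonempty] using h)
  simp only [Finset.mem_filter, Finset.mem_univ, true_and, Prod.Lex.toLex_le_toLex] at hi hmin
  refine ⟨i, hi, fun l hl => ?_⟩
  have := hmin l hl
  grind

theorem isEndpoint_iff {σ g : Fin k → ℝ} (hσ : ∀ l, σ l = 1 ∨ σ l = -1 ∨ σ l = 0) {s : ℝ}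
    (hs : s = 1 ∨ s = -1) {i₀ : Fin k}
    (h₀ : σ i₀ = s ∧ ∀ l, σ l = s → g i₀ ≤ g l ∧ (l < i₀ → g i₀ < g l)) {i : Fin k}
    (hi : σ i = s) :
    IsEndpoint σ g i ↔ i = i₀ ∧ (∀ l, σ l = 0 → 0 ≤ g l) ∧
      ∀ l l', σ l = 1 → σ l' = -1 → 0 ≤ g l + g l' := by
  obtain ⟨hi₀, hmin⟩ := h₀
  have hss : s * s = 1 := by rcases hs with rfl | rfl <;> norm_num
  constructor
  · intro h
    have hle : ∀ l, 0 ≤ g l - σ l * (σ i * g i) := fun l => by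
      have := h l
      unfold HalfLineCond at this
      split_ifs at this with hb
      · exact this
      · exact this.le
    refine ⟨?_, fun l hl => by simpa [hl] using hle l, fun l l' hl hl' => ?_⟩
    · have h1 := hmin i hi
      have h2 := hle i₀
      rw [hi₀, hi, ← mul_assoc, hss, one_mul] at h2
      rcases lt_trichotomy i i₀ with hlt | heq | hlt
      · linarith [h1.2 hlt]
      · exact heq
      · have h3 := h i₀
        simp only [HalfLineCond, hi₀, hi, hlt, ← mul_assoc, hss] at h3
        simp at h3
        linarith
    · have h1 := hle l
      have h2 := hle l'
      have h3 := hle i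
      rw [hl, hi] at h1
      rw [hl', hi] at h2
      rcases hs with rfl | rfl <;> linarith
  · rintro ⟨rfl, h0, hpair⟩ l
    rw [hi]
    rcases eq_or_ne (σ l) s with hl | hl
    · have h1 := hmin l hl
      rw [hl, ← mul_assoc, hss, one_mul]
      by_cases hlt : l < i
      · simpa [HalfLineCond, hlt] using h1.2 hlt
      · simpa [HalfLineCond, hlt] using h1.1
    · simp only [HalfLineCond, hl, false_and, decide_false, Bool.not_false, if_true]
      rcases hσ l with h1 | h1 | h1
      · have hs' : s = -1 := hs.resolve_left fun h => hl (h1.trans h.symm)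
        have := hpair l i h1 (hi.trans hs')
        rw [h1, hs']
        linarith
      · have hs' : s = 1 := hs.resolve_right fun h => hl (h1.trans h.symm)
        have := hpair i l (hi.trans hs') h1
        rw [h1, hs']
        linarith
      · rw [h1]
        linarith [h0 l h1]

/-- The integral over the slice `{τ | τ² + a ≤ c}`. -/
theorem setIntegral_sq_add_le (h : ℝ → ℂ) (a c : ℝ) :
    ∫ τ in {τ : ℝ | τ ^ 2 + a ≤ c}, h τ = sqSubIntegral h 0 (√(c - a)) := by
  simp only [sqSubIntegral, pow_zero, one_mul]
  rw [intervalIntegral.integral_of_le (by linarith [Real.sqrt_nonneg (c - a)]),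
    ← integral_Icc_eq_integral_Ioc]
  rcases le_or_gt 0 (c - a) with hc | hc
  · congr 2
    ext τ
    rw [Set.mem_ofPred_eq, Set.mem_Icc, ← abs_le, Real.le_sqrt (abs_nonneg _) hc, sq_abs]
    constructor <;> intro <;> linarith
  · have h1 : {τ : ℝ | τ ^ 2 + a ≤ c} = ∅ := by
      ext τ
      simp only [Set.mem_ofPred_eq, Set.mem_empty_iff_false, iff_false, not_le]
      nlinarith [sq_nonneg τ]
    rw [h1, Real.sqrt_eq_zero_of_nonpos hc.le]
    simp

theorem setIntegral_sq_add_lt (h : ℝ → ℂ) (a c : ℝ) :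
    ∫ τ in {τ : ℝ | τ ^ 2 + a < c}, h τ = sqSubIntegral h 0 (√(c - a)) := by
  simp only [sqSubIntegral, pow_zero, one_mul]
  rw [intervalIntegral.integral_of_le (by linarith [Real.sqrt_nonneg (c - a)]),
    integral_Ioc_eq_integral_Ioo]
  congr 2
  ext τ
  rw [Set.mem_ofPred_eq, Set.mem_Ioo, ← abs_lt, Real.lt_sqrt (abs_nonneg _), sq_abs]
  constructor <;> intro <;> linarith

/-- The integral over a slice is a signed sum over the admissible endpoints. -/
theorem setIntegral_slice {σ g : Fin k → ℝ} (hσ : ∀ l, σ l = 1 ∨ σ l = -1 ∨ σ l = 0)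
    (hpos : ∃ i, σ i = 1) {h : ℝ → ℂ} (hh : Continuous h) (a : ℝ) :
    ∫ τ in {τ : ℝ | ∀ l, 0 ≤ g l - σ l * (τ ^ 2 + a)}, h τ =
      ∑ i, (σ i : ℂ) * {g | IsEndpoint σ g i}.indicator
        (fun g => sqSubIntegral h 0 (√(σ i * g i - a))) g := by
  classical
  obtain ⟨p, hp, hpmin⟩ := exists_first_min σ g hpos
  have hEp := fun i (hi : σ i = 1) => isEndpoint_iff hσ (Or.inl rfl) ⟨hp, hpmin⟩ hi
  by_cases hD : (∀ l, σ l = 0 → 0 ≤ g l) ∧ ∀ l l', σ l = 1 → σ l' = -1 → 0 ≤ g l + g l'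
  swap
  · have hempty : {τ : ℝ | ∀ l, 0 ≤ g l - σ l * (τ ^ 2 + a)} = ∅ := by
      refine Set.eq_empty_of_forall_notMem fun τ hτ => hD ⟨fun l hl => ?_, fun l l' hl hl' => ?_⟩
      · simpa [hl] using hτ l
      · have h1 := hτ l
        have h2 := hτ l'
        rw [hl] at h1
        rw [hl'] at h2
        linarith
    rw [hempty, setIntegral_empty, Finset.sum_eq_zero]
    intro i _
    rcases hσ i with hi | hi | hi
    · rw [Set.indicator_of_notMem, mul_zero]
      exact fun hE => hD ((hEp i hi).1 hE).2
    · rw [Set.indicator_of_notMem, mul_zero]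
      obtain ⟨q, hq⟩ := exists_first_min σ g ⟨i, hi⟩
      exact fun hE => hD ((isEndpoint_iff hσ (Or.inr rfl) hq hi).1 hE).2
    · simp [hi]
  have hset : {τ : ℝ | ∀ l, 0 ≤ g l - σ l * (τ ^ 2 + a)} =
      {τ | τ ^ 2 + a ≤ g p} ∩ {τ | ∀ l, σ l = -1 → - g l ≤ τ ^ 2 + a} := by
    ext τ
    refine ⟨fun hτ => ⟨?_, fun l hl => ?_⟩, fun hτ l => ?_⟩
    · have := hτ p
      rw [hp] at this
      simp only [Set.mem_ofPred_eq]
      linarith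
    · have := hτ l
      rw [hl] at this
      linarith
    · have h1 : τ ^ 2 + a ≤ g p := hτ.1
      rcases hσ l with hl | hl | hl
      · rw [hl]
        linarith [(hpmin l hl).1]
      · rw [hl]
        linarith [hτ.2 l hl]
      · rw [hl]
        linarith [hD.1 l hl]
  by_cases hneg : ∃ i, σ i = -1
  · obtain ⟨q, hq, hqmin⟩ := exists_first_min σ g hneg
    have hEq := fun i (hi : σ i = -1) => isEndpoint_iff hσ (Or.inr rfl) ⟨hq, hqmin⟩ hi
    have hpq := hD.2 p q hp hq
    have hterm : ∀ i, (σ i : ℂ) * {g | IsEndpoint σ g i}.indicator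
        (fun g => sqSubIntegral h 0 (√(σ i * g i - a))) g =
        (if i = p then sqSubIntegral h 0 (√(g p - a)) else 0) -
          (if i = q then sqSubIntegral h 0 (√(-g q - a)) else 0) := by
      intro i
      simp only [Set.indicator, Set.mem_ofPred_eq]
      rcases hσ i with hi | hi | hi
      · have hiq : i ≠ q := by rintro rfl; norm_num [hi] at hq
        simp only [hEp i hi, and_iff_left hD, hiq, hi]
        by_cases hip : i = p <;> simp [hip]
      · have hip : i ≠ p := by rintro rfl; norm_num [hi] at hp
        simp only [hEq i hi, and_iff_left hD, hip, hi]
        by_cases hiq : i = q <;> simp [hiq]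
      · have hiq : i ≠ q := by rintro rfl; norm_num [hi] at hq
        have hip : i ≠ p := by rintro rfl; norm_num [hi] at hp
        simp [hi, hip, hiq]
    have hset' : {τ : ℝ | ∀ l, 0 ≤ g l - σ l * (τ ^ 2 + a)} =
        {τ | τ ^ 2 + a ≤ g p} \ {τ | τ ^ 2 + a < -g q} := by
      rw [hset]
      ext τ
      simp only [Set.mem_inter_iff, Set.mem_sdiff, Set.mem_ofPred_eq, not_lt]
      refine and_congr_right fun _ => ⟨fun hτ => hτ q hq, fun hτ l hl => ?_⟩
      linarith [(hqmin l hl).1]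
    have hint : IntegrableOn h {τ : ℝ | τ ^ 2 + a ≤ g p} := by
      refine (hh.integrableOn_Icc (a := -√(g p - a)) (b := √(g p - a))).mono_set fun τ hτ => ?_
      exact abs_le.1 (Real.abs_le_sqrt (by linarith [Set.mem_ofPred_eq ▸ hτ]))
    rw [Finset.sum_congr rfl fun i _ => hterm i, Finset.sum_sub_distrib, hset',
      setIntegral_sdiff (measurableSet_lt (by fun_prop) (by fun_prop)) hint
        (fun τ hτ => by simp only [Set.mem_ofPred_eq] at hτ ⊢; linarith),
      setIntegral_sq_add_le, setIntegral_sq_add_lt]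
    simp
  · push Not at hneg
    have hterm : ∀ i, (σ i : ℂ) * {g | IsEndpoint σ g i}.indicator
        (fun g => sqSubIntegral h 0 (√(σ i * g i - a))) g =
        if i = p then sqSubIntegral h 0 (√(g p - a)) else 0 := by
      intro i
      simp only [Set.indicator, Set.mem_ofPred_eq]
      rcases hσ i with hi | hi | hi
      · simp only [hEp i hi, and_iff_left hD, hi]
        by_cases hip : i = p <;> simp [hip]
      · exact absurd hi (hneg i)
      · have hip : i ≠ p := by rintro rfl; norm_num [hi] at hp
        simp [hi, hip]
    have hset' : {τ : ℝ | ∀ l, 0 ≤ g l - σ l * (τ ^ 2 + a)} = {τ | τ ^ 2 + a ≤ g p} := by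
      rw [hset]
      exact Set.inter_eq_left.2 fun τ _ l hl => absurd hl (hneg l)
    rw [Finset.sum_congr rfl fun i _ => hterm i, hset', setIntegral_sq_add_le]
    simp

end Slices

section Reduction

variable {d k : ℕ}

/-- The trace of a family of half-spaces in the coordinates `(τ, z) ∈ ℝ × ℝᵈ`; the sign `σ l` is
`1` for a ball, `-1` for the complement of a ball and `0` for an affine half-space. -/
def dhRegion (σ : Fin k → ℝ) (w : Fin k → EuclideanSpace ℝ (Fin d)) (s : Fin k → ℝ) :
    Set (ℝ × EuclideanSpace ℝ (Fin d)) :=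
  {p | ∀ l, 0 ≤ ⟪w l, p.2⟫ + s l - σ l * (p.1 ^ 2 + ‖p.2‖ ^ 2)}

theorem isClosed_dhRegion (σ : Fin k → ℝ) (w : Fin k → EuclideanSpace ℝ (Fin d)) (s : Fin k → ℝ) :
    IsClosed (dhRegion σ w s) := by
  simp only [dhRegion, Set.ofPred_forall]
  exact isClosed_iInter fun l => isClosed_le (by fun_prop) (by fun_prop)

theorem isBounded_dhRegion {σ : Fin k → ℝ} {w : Fin k → EuclideanSpace ℝ (Fin d)} {s : Fin k → ℝ}
    (hb : ∃ i, σ i = 1 ∧ w i = 0) : Bornology.IsBounded (dhRegion σ w s) := by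
  obtain ⟨i, hi, hwi⟩ := hb
  refine isBounded_closedBall (x := (0 : ℝ × EuclideanSpace ℝ (Fin d))) (r := √(s i)) |>.subset ?_
  intro p hp
  have h1 := hp i
  rw [hi, hwi, inner_zero_left] at h1
  rw [mem_closedBall_zero_iff, Prod.norm_def, max_le_iff, Real.norm_eq_abs]
  refine ⟨Real.abs_le_sqrt ?_, Real.le_sqrt_of_sq_le ?_⟩ <;>
    linarith [sq_nonneg p.1, sq_nonneg ‖p.2‖]

theorem isEndpoint_affine_iff (σ : Fin k → ℝ) (w : Fin k → EuclideanSpace ℝ (Fin d))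
    (s : Fin k → ℝ) (i : Fin k) (z : EuclideanSpace ℝ (Fin d)) :
    IsEndpoint σ (fun l => ⟪w l, z⟫ + s l) i ↔
      z ∈ polyhedron (fun l => !decide (σ l = σ i ∧ l < i))
        (fun l => w l - (σ l * σ i) • w i) (fun l => 0 - (s l - σ l * σ i * s i)) := by
  refine forall_congr' fun l => ?_
  rw [halfLineCond_sub_iff, inner_sub_left, real_inner_smul_left]
  ring_nf

/-- Slicing in the `τ`-direction reduces the integral over a region to integrals over cells. -/
theorem norm_setIntegral_dhRegion_le {ε K : ℝ} (hε : 0 < ε)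
    (hK : ∀ (b : Fin k → Bool) (v : Fin k → EuclideanSpace ℝ (Fin d)) (t : Fin k → ℝ)
      (w : EuclideanSpace ℝ (Fin d)) (s : ℝ), ‖∫ z in polyhedron b v t,
        sqSubIntegral (fun x => dhKernel (d + 1) ε x) 0 (√(⟪w, z⟫ + s - ‖z‖ ^ 2))‖ ≤ K)
    {σ : Fin k → ℝ} (hσ : ∀ l, σ l = 1 ∨ σ l = -1 ∨ σ l = 0)
    (w : Fin k → EuclideanSpace ℝ (Fin d)) (s : Fin k → ℝ) (hb : ∃ i, σ i = 1 ∧ w i = 0) :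
    ‖∫ p in dhRegion σ w s, dhKernel (d + 1) ε (p.1 : ℂ)‖ ≤ k * K := by
  have hm := (isClosed_dhRegion σ w s).measurableSet
  set h : ℝ → ℂ := fun x => dhKernel (d + 1) ε x
  have hh : Continuous h := continuous_dhKernel _ hε
  have hint : IntegrableOn (fun p : ℝ × EuclideanSpace ℝ (Fin d) => h p.1) (dhRegion σ w s) :=
    (hh.comp continuous_fst).continuousOn.integrableOn_compact
      (isCompact_of_isClosed_isBounded (isClosed_dhRegion σ w s) (isBounded_dhRegion hb))
  let F : ℝ → ℂ := fun u => sqSubIntegral h 0 (√u)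
  have hF : Continuous F := (continuous_sqSubIntegral hh 0).comp Real.continuous_sqrt
  have hF0 : ∀ u ≤ 0, F u = 0 := fun u hu => by
    simp [F, Real.sqrt_eq_zero_of_nonpos hu, sqSubIntegral]
  let Q : Fin k → Set (EuclideanSpace ℝ (Fin d)) := fun i =>
    polyhedron (fun l => !decide (σ l = σ i ∧ l < i))
      (fun l => w l - (σ l * σ i) • w i) (fun l => 0 - (s l - σ l * σ i * s i))
  have hslice : ∀ z : EuclideanSpace ℝ (Fin d),
      ∫ τ, (dhRegion σ w s).indicator (fun p => h p.1) (τ, z) =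
        ∑ i, (σ i : ℂ) * (Q i).indicator
          (fun z => F (⟪σ i • w i, z⟫ + σ i * s i - ‖z‖ ^ 2)) z := by
    intro z
    have h1 := setIntegral_slice (g := fun l => ⟪w l, z⟫ + s l) hσ (hb.imp fun _ => And.left) hh
      (‖z‖ ^ 2)
    have hms : MeasurableSet {τ : ℝ | ∀ l, 0 ≤ ⟪w l, z⟫ + s l - σ l * (τ ^ 2 + ‖z‖ ^ 2)} :=
      hm.preimage (by fun_prop : Measurable fun τ : ℝ => (τ, z))
    rw [← integral_indicator hms] at h1
    refine Eq.trans ?_ (h1.trans (Finset.sum_congr rfl fun i _ => ?_))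
    · rfl
    · congr 1
      have h2 := isEndpoint_affine_iff σ w s i z
      by_cases hz : z ∈ Q i
      · rw [Set.indicator_of_mem hz,
          Set.indicator_of_mem (s := {g | IsEndpoint σ g i}) (h2.2 hz),
          real_inner_smul_left, mul_add]
      · rw [Set.indicator_of_notMem hz, Set.indicator_of_notMem]
        exact fun h => hz (h2.1 h)
  have hQ : ∀ i, MeasurableSet (Q i) := fun i => measurableSet_polyhedron _ _ _
  rw [← integral_indicator hm, Measure.volume_eq_prod, integral_prod_symm _
    ((integrable_indicator_iff hm).2 hint)]
  simp only [hslice]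
  rw [integral_finsetSum _ fun i _ => (((integrable_comp_affine_sub_norm_sq hF hF0 _ _).indicator
    (hQ i)).const_mul _)]
  refine (norm_sum_le _ _).trans ((Finset.sum_le_card_nsmul _ _ K fun i _ => ?_).trans_eq (by simp))
  rw [integral_const_mul, integral_indicator (hQ i), norm_mul]
  have h1 : ‖(σ i : ℂ)‖ ≤ 1 := by
    rcases hσ i with h | h | h <;> simp [h]
  exact (mul_le_of_le_one_left (norm_nonneg _) h1).trans (hK _ _ _ _ _)

theorem norm_smul_single_add_sq
    (j : EuclideanSpace ℝ (Fin d) →ₗᵢ[ℝ] EuclideanSpace ℝ (Fin (d + 1)))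
    (hj : ∀ z, ⟪EuclideanSpace.single 0 (1 : ℝ), j z⟫ = 0) (τ : ℝ) (z : EuclideanSpace ℝ (Fin d)) :
    ‖τ • EuclideanSpace.single 0 (1 : ℝ) + j z‖ ^ 2 = τ ^ 2 + ‖z‖ ^ 2 := by
  rw [norm_add_sq_real, real_inner_smul_left, hj, norm_smul, j.norm_map]
  simp

/-- In the coordinates `x = τ e₀ + j z`, each half-space is given by a sign and an affine function
of `z`. -/
theorem IsDHHalfSpace.exists_mem_iff
    (j : EuclideanSpace ℝ (Fin d) →ₗᵢ[ℝ] EuclideanSpace ℝ (Fin (d + 1)))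
    (hj : ∀ z, ⟪EuclideanSpace.single 0 (1 : ℝ), j z⟫ = 0)
    {H : Set (EuclideanSpace ℝ (Fin (d + 1)))} (hH : IsDHHalfSpace H) :
    ∃ (σ : ℝ) (w : EuclideanSpace ℝ (Fin d)) (s : ℝ), (σ = 1 ∨ σ = -1 ∨ σ = 0) ∧
      ∀ (τ : ℝ) z, τ • EuclideanSpace.single 0 (1 : ℝ) + j z ∈ H ↔
        0 ≤ ⟪w, z⟫ + s - σ * (τ ^ 2 + ‖z‖ ^ 2) := by
  set e : EuclideanSpace ℝ (Fin (d + 1)) := EuclideanSpace.single 0 1 with he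
  let A := ContinuousLinearMap.adjoint j.toContinuousLinearMap
  have hin : ∀ c : EuclideanSpace ℝ (Fin (d + 1)), c 0 = 0 → ∀ (τ : ℝ) z,
      ⟪c, τ • e + j z⟫ = ⟪A c, z⟫ := by
    intro c hc τ z
    rw [inner_add_right, real_inner_smul_right, he, EuclideanSpace.inner_single_right, hc,
      ContinuousLinearMap.adjoint_inner_left]
    simp
  have hdist : ∀ c : EuclideanSpace ℝ (Fin (d + 1)), c 0 = 0 → ∀ (τ : ℝ) z,
      dist (τ • e + j z) c ^ 2 = τ ^ 2 + ‖z‖ ^ 2 - ⟪(2 : ℝ) • A c, z⟫ + ‖c‖ ^ 2 := by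
    intro c hc τ z
    rw [dist_eq_norm, norm_sub_sq_real, norm_smul_single_add_sq j hj, real_inner_comm, hin c hc, real_inner_smul_left]
  rcases hH with ⟨c, r, hr, hc, rfl⟩ | ⟨c, r, hr, hc, rfl⟩ | ⟨v, t, -, hv, rfl⟩
  · refine ⟨1, (2 : ℝ) • A c, r ^ 2 - ‖c‖ ^ 2, by simp, fun τ z => ?_⟩
    rw [mem_closedBall, ← pow_le_pow_iff_left₀ dist_nonneg hr.le two_ne_zero, hdist c hc]
    constructor <;> intro <;> linarith
  · refine ⟨-1, -((2 : ℝ) • A c), ‖c‖ ^ 2 - r ^ 2, by simp, fun τ z => ?_⟩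
    rw [Set.mem_compl_iff, mem_ball, not_lt, ← pow_le_pow_iff_left₀ hr.le dist_nonneg two_ne_zero,
      hdist c hc, inner_neg_left]
    constructor <;> intro <;> linarith
  · refine ⟨0, A v, -t, by simp, fun τ z => ?_⟩
    rw [Set.mem_ofPred_eq, hin v hv]
    constructor <;> intro <;> linarith

/-- The value of `dhInt` for a bounded intersection of exactly `k` half-spaces is bounded in terms
of `k` and the dimension only. -/
theorem exists_norm_dhInt_le (d k : ℕ) : ∃ C : ℝ, 0 ≤ C ∧
    ∀ S : Finset (Set (EuclideanSpace ℝ (Fin (d + 1)))), S.card = k → (∀ H ∈ S, IsDHHalfSpace H) →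
      Bornology.IsBounded (⋂₀ (S : Set (Set (EuclideanSpace ℝ (Fin (d + 1)))))) →
        ∀ ε : ℝ, 0 < ε → ‖dhInt (d + 1) (⋂₀ ↑S) ε‖ ≤ C := by
  obtain ⟨K, hK0, hK⟩ := exists_norm_integral_dhKernel_cell_le d (k + 1)
  refine ⟨(k + 1 : ℕ) * K, by positivity, ?_⟩
  rintro S rfl hS hbdd ε hε
  set e : EuclideanSpace ℝ (Fin (d + 1)) := EuclideanSpace.single 0 1 with he
  obtain ⟨j, hj, hmp, hemb⟩ := exists_orthogonal_splitting e (by simp [he])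
  obtain ⟨ρ, hρ⟩ := hbdd.subset_closedBall (0 : EuclideanSpace ℝ (Fin (d + 1)))
  choose σ w s hσ hmem using fun i : Fin S.card =>
    (hS _ (S.equivFin.symm i).2).exists_mem_iff j hj
  have hpre : (fun p : ℝ × EuclideanSpace ℝ (Fin d) => p.1 • e + j p.2) ⁻¹' (⋂₀ ↑S) =
      dhRegion (Fin.cons 1 σ : Fin (S.card + 1) → ℝ)
        (Fin.cons 0 w : Fin (S.card + 1) → EuclideanSpace ℝ (Fin d))
        (Fin.cons (ρ ^ 2) s : Fin (S.card + 1) → ℝ) := by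
    ext p
    simp only [dhRegion, Set.mem_preimage, Set.mem_ofPred_eq, Fin.forall_fin_succ, Fin.cons_zero,
      Fin.cons_succ, inner_zero_left, ← hmem]
    constructor
    · intro hp
      refine ⟨?_, fun i => hp _ (S.equivFin.symm i).2⟩
      have h1 : ‖p.1 • e + j p.2‖ ≤ ρ := by simpa using hρ hp
      have h2 := pow_le_pow_left₀ (norm_nonneg _) h1 2
      rw [norm_smul_single_add_sq j hj] at h2
      linarith
    · rintro ⟨-, hp⟩ H hH
      simpa using hp (S.equivFin ⟨H, hH⟩)
  have hval : dhInt (d + 1) (⋂₀ ↑S) ε = ∫ p in dhRegion (Fin.cons 1 σ : Fin (S.card + 1) → ℝ)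
        (Fin.cons 0 w : Fin (S.card + 1) → EuclideanSpace ℝ (Fin d))
        (Fin.cons (ρ ^ 2) s : Fin (S.card + 1) → ℝ), dhKernel (d + 1) ε (p.1 : ℂ) := by
    rw [← hpre, dhInt, ← hmp.setIntegral_preimage_emb hemb]
    refine integral_congr_ae (Eventually.of_forall fun p => ?_)
    have h0 : (j p.2) 0 = 0 := by
      have := hj p.2
      rw [he, EuclideanSpace.inner_single_left] at this
      simpa using this
    simp [dhKernel, he, h0]
  rw [hval]
  refine norm_setIntegral_dhRegion_le hε (hK ε hε) (fun l => ?_) _ _ ⟨0, by simp⟩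
  refine Fin.cases ?_ (fun i => ?_) l
  · simp
  · simpa using hσ i

end Reduction

end

/-- **Uniform boundedness of `μ_ε(P)` for a fixed number of half-spaces**
(Theorem 3.2(2) / Lemma 6.1(2)): for fixed `n ≥ 1` and `m ≥ 1` there is a constant `C`
such that `|μ_ε(P)| ≤ C` for every bounded intersection `P` of at most `m` DH-half-spaces
and every `ε > 0`. -/
theorem dh_mu_uniformly_bounded (n m : ℕ) [NeZero n] (hm : 1 ≤ m) :
    ∃ C : ℝ, ∀ P : Set (EuclideanSpace ℝ (Fin n)),
      (∃ S : Finset (Set (EuclideanSpace ℝ (Fin n))),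
        S.card ≤ m ∧ (∀ H ∈ S, IsDHHalfSpace H) ∧ P = ⋂₀ ↑S) →
      Bornology.IsBounded P →
      ∀ ε : ℝ, 0 < ε → ‖dhInt n P ε‖ ≤ C := by
  obtain ⟨d, rfl⟩ := Nat.exists_eq_succ_of_ne_zero (NeZero.ne n)
  choose K hK0 hK using exists_norm_dhInt_le d
  refine ⟨∑ k ∈ Finset.range (m + 1), K k, ?_⟩
  rintro _ ⟨S, hcard, hS, rfl⟩ hbdd ε hε
  exact (hK _ S rfl hS hbdd ε hε).trans (Finset.single_le_sum (f := K) (fun k _ => hK0 k)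
    (Finset.mem_range.2 (Nat.lt_succ_of_le hcard)))
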